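/- Let Λ be a right 4-Nakayama artin algebra and let M be a finitely generated indecomposable non-local 3-factor serial right Λ-module which is not isomorphic to a quotient of any indecomposable non-local, non-colocal 4-factor serial right Λ-module. Let M1 and M2 be the two uniserial maximal submodules of M (each of length 2) and let S = soc(M) = M1 ∩ M2 be its simple socle. Then the short exact sequence 0 → S → M1 ⊕ M2 → M → 0, where the first map sends s to (s, s) and the second map sends (m1, m2) to m2 − m1, is an almost split sequence. -/

import Mathlib

/-! Basic definitions for (right) modules over a ring: radical, socle, length,
uniserial, local, indecomposable, `n`-factor serial, right `n`-Nakayama algebras,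
Nakayama algebras and almost split sequences. -/

universe u v w

section ModuleDefs

variable (A : Type v) [Ring A] (M : Type w) [AddCommGroup M] [Module A M]

/-- The composition length of a module, i.e. the Krull dimension of its submodule lattice. -/
noncomputable def moduleLength : WithBot ℕ∞ := Order.krullDim (Submodule A M)

/-- The radical of a module: the intersection of all its maximal submodules. -/
def moduleRad : Submodule A M := sInf {N : Submodule A M | IsCoatom N}

/-- The socle of a module: the sum of all its simple submodules. -/
def moduleSoc : Submodule A M := sSup {N : Submodule A M | IsAtom N}

variable {A M}

/-- The radical of a submodule `N`, viewed as a submodule of the ambient module. -/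
def radOf (N : Submodule A M) : Submodule A M :=
  Submodule.map N.subtype (moduleRad A ↥N)

/-- The socle of a submodule `N`, viewed as a submodule of the ambient module. -/
def socOf (N : Submodule A M) : Submodule A M :=
  Submodule.map N.subtype (moduleSoc A ↥N)

variable (A M)

/-- The iterated radical `rad^n(M)`, as a submodule of `M`. -/
def radPow : ℕ → Submodule A M
  | 0 => ⊤
  | n + 1 => radOf (radPow n)

/-- A module is uniserial if its submodules are totally ordered by inclusion. -/
def IsUniserialModule : Prop := ∀ N P : Submodule A M, N ≤ P ∨ P ≤ N

/-- A module is local if it has a unique maximal submodule. -/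
def IsLocalModule : Prop := ∃! N : Submodule A M, IsCoatom N

/-- A module is colocal if its socle is a simple submodule. -/
def IsColocalModule : Prop := IsAtom (moduleSoc A M)

/-- A module is indecomposable if it is nonzero and is not the direct sum of two
nonzero submodules. -/
def IsIndecModule : Prop :=
  Nontrivial M ∧ ∀ N P : Submodule A M, IsCompl N P → N = ⊥ ∨ P = ⊥

/-- The Loewy length of a module: the least `n` with `rad^n(M) = 0`. -/
noncomputable def loewyLength : ℕ := sInf {n : ℕ | radPow A M n = ⊥}

/-- A module `M` of length `l` is `n`-factor serial (`l ≥ n > 1`) if it is not uniserial,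
`M/rad^{l-n}(M)` is uniserial and `M/rad^{l-n+1}(M)` is not uniserial. -/
def IsNFactorSerial (n : ℕ) : Prop :=
  1 < n ∧ ¬ IsUniserialModule A M ∧
  ∃ l : ℕ, moduleLength A M = l ∧ n ≤ l ∧
    IsUniserialModule A (M ⧸ radPow A M (l - n)) ∧
    ¬ IsUniserialModule A (M ⧸ radPow A M (l - n + 1))

/-- `M` is `n`-factor serial, where `1`-factor serial means uniserial. -/
def IsFactorSerial (n : ℕ) : Prop :=
  (n = 1 ∧ IsUniserialModule A M) ∨ IsNFactorSerial A M n

end ModuleDefs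

section AlgebraDefs

variable (Λ : Type u) [Ring Λ]

/-- A ring `Λ` is right `n`-Nakayama if every finitely generated indecomposable right
`Λ`-module is `i`-factor serial for some `1 ≤ i ≤ n`, and there is at least one finitely
generated indecomposable `n`-factor serial right `Λ`-module.  Right `Λ`-modules are
realized as left `Λᵐᵒᵖ`-modules. -/
def IsRightNNakayama (n : ℕ) : Prop :=
  (∀ M : ModuleCat.{u} Λᵐᵒᵖ, Module.Finite Λᵐᵒᵖ M → IsIndecModule Λᵐᵒᵖ M →
      ∃ i, 1 ≤ i ∧ i ≤ n ∧ IsFactorSerial Λᵐᵒᵖ M i) ∧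
  ∃ M : ModuleCat.{u} Λᵐᵒᵖ, Module.Finite Λᵐᵒᵖ M ∧ IsIndecModule Λᵐᵒᵖ M ∧
    IsNFactorSerial Λᵐᵒᵖ M n

/-- A ring `Λ` is a Nakayama algebra if every finitely generated indecomposable projective
right `Λ`-module and every finitely generated indecomposable projective left `Λ`-module is
uniserial. -/
def IsNakayamaAlgebra : Prop :=
  (∀ M : ModuleCat.{u} Λᵐᵒᵖ, Module.Finite Λᵐᵒᵖ M → Module.Projective Λᵐᵒᵖ M →
      IsIndecModule Λᵐᵒᵖ M → IsUniserialModule Λᵐᵒᵖ M) ∧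
  (∀ M : ModuleCat.{u} Λ, Module.Finite Λ M → Module.Projective Λ M →
      IsIndecModule Λ M → IsUniserialModule Λ M)

end AlgebraDefs

section AlmostSplit

variable {A : Type v} [Ring A]

/-- A pair of maps `f : X → Y`, `g : Y → Z` is an almost split (Auslander-Reiten) sequence
if `0 → X → Y → Z → 0` is a non-split short exact sequence with `X` and `Z` indecomposable,
such that every homomorphism `V → Z` from a finitely generated module which is not a split
epimorphism factors through `g`. -/
def IsAlmostSplitSequence {X Y Z : Type w} [AddCommGroup X] [Module A X]
    [AddCommGroup Y] [Module A Y] [AddCommGroup Z] [Module A Z]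
    (f : X →ₗ[A] Y) (g : Y →ₗ[A] Z) : Prop :=
  Function.Injective f ∧ Function.Surjective g ∧ LinearMap.range f = LinearMap.ker g ∧
  (¬ ∃ s : Z →ₗ[A] Y, g ∘ₗ s = LinearMap.id) ∧
  IsIndecModule A X ∧ IsIndecModule A Z ∧
  ∀ V : ModuleCat.{w} A, Module.Finite A V →
    ∀ h : V →ₗ[A] Z, (¬ ∃ s : Z →ₗ[A] V, h ∘ₗ s = LinearMap.id) →
      ∃ k : V →ₗ[A] Y, g ∘ₗ k = h

end AlmostSplit

section Length

variable {A : Type v} [Ring A]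

lemma moduleLength_eq_coe_length (M : Type w) [AddCommGroup M] [Module A M] :
    moduleLength A M = (Module.length A M : WithBot ℕ∞) :=
  (Module.coe_length A M).symm

lemma exists_length_eq_natCast [IsArtinianRing A] (M : Type w) [AddCommGroup M] [Module A M]
    [Module.Finite A M] : ∃ n : ℕ, Module.length A M = n :=
  ENat.ne_top_iff_exists.mp Module.length_ne_top |>.imp fun _ h ↦ h.symm

variable {M N : Type*} [AddCommGroup M] [Module A M] [AddCommGroup N] [Module A N]

lemma length_eq_length_ker_add_length_range (f : M →ₗ[A] N) :
    Module.length A M = Module.length A f.ker + Module.length A f.range :=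
  Module.length_eq_add_of_exact f.ker.subtype f.rangeRestrict (Submodule.subtype_injective _)
    f.surjective_rangeRestrict fun x ↦ by simp [Subtype.ext_iff]

lemma length_comap_of_surjective {f : M →ₗ[A] N} (hf : Function.Surjective f)
    (P : Submodule A N) :
    Module.length A (P.comap f) = Module.length A f.ker + Module.length A P := by
  refine Module.length_eq_add_of_exact
    (Submodule.inclusion (show f.ker ≤ P.comap f from fun x hx ↦ ?_)) (f.submoduleComap P)
    (Submodule.inclusion_injective _) (f.submoduleComap_surjective_of_surjective P hf) fun x ↦ ?_
  · simp_all
  · rw [Subtype.ext_iff]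
    exact ⟨fun h ↦ ⟨⟨x, h⟩, rfl⟩, by rintro ⟨y, rfl⟩; exact y.2⟩

lemma length_eq_of_isCoatom {P : Submodule A M} (hP : IsCoatom P) :
    Module.length A M = Module.length A P + 1 := by
  have := isSimpleModule_iff_isCoatom.mpr hP
  rw [← Module.length_eq_one (R := A) (M := M ⧸ P)]
  exact Module.length_eq_add_of_exact P.subtype P.mkQ P.subtype_injective P.mkQ_surjective
    (LinearMap.exact_subtype_mkQ P)

lemma bijective_or_length_lt_of_ker_eq_bot [IsArtinian A N] [IsNoetherian A N] (f : M →ₗ[A] N)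
    (hf : f.ker = ⊥) : Function.Bijective f ∨ Module.length A M < Module.length A N := by
  by_cases hsurj : Function.Surjective f
  · exact .inl ⟨LinearMap.ker_eq_bot.mp hf, hsurj⟩
  · have := length_eq_length_ker_add_length_range f
    rw [hf, Module.length_bot, zero_add] at this
    exact .inr (this ▸ Submodule.length_lt (mt LinearMap.range_eq_top.mp hsurj))

lemma length_eq_add_of_isCompl {P Q : Submodule A M} (h : IsCompl P Q) :
    Module.length A M = Module.length A P + Module.length A Q := by
  rw [← (P.prodEquivOfIsCompl Q h).length_eq, Module.length_prod]

lemma isAtom_iff_length_eq_one {P : Submodule A M} : IsAtom P ↔ Module.length A P = 1 := by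
  rw [Module.length_eq_one_iff, isSimpleModule_iff_isAtom]

lemma le_moduleSoc_of_length_le_one {P : Submodule A M} (h : Module.length A P ≤ 1) :
    P ≤ moduleSoc A M := by
  rcases h.lt_or_eq with h | h
  · rw [Order.lt_one_iff, Module.length_eq_zero_iff, Submodule.subsingleton_iff_eq_bot] at h
    simp [h]
  · exact le_sSup (isAtom_iff_length_eq_one.mpr h)

lemma map_le_moduleSoc {P : Submodule A M} (f : M →ₗ[A] N) (h : Module.length A P ≤ 1) :
    P.map f ≤ moduleSoc A N :=
  le_moduleSoc_of_length_le_one <|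
    (Module.length_le_of_surjective _ (f.submoduleMap_surjective P)).trans h

lemma moduleSoc_le_of_ne_bot [IsArtinian A M] (hs : IsAtom (moduleSoc A M)) {P : Submodule A M}
    (hP : P ≠ ⊥) : moduleSoc A M ≤ P := by
  obtain ⟨Q, hQ, hQP⟩ := (eq_bot_or_exists_atom_le P).resolve_left hP
  have : Q = moduleSoc A M := (hs.le_iff_eq hQ.1).mp (le_sSup hQ)
  exact this ▸ hQP

lemma map_subtype_ne_bot {P : Submodule A M} {Q : Submodule A P} (hQ : Q ≠ ⊥) :
    Q.map P.subtype ≠ ⊥ := fun h ↦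
  hQ <| Submodule.map_injective_of_injective P.subtype_injective <|
    h.trans (Submodule.map_bot _).symm

end Length

section FactorSerial

variable {A : Type v} [Ring A] {M : Type*} [AddCommGroup M] [Module A M]

lemma not_isUniserialModule_quotient {P Q N : Submodule A M} (hP : IsCoatom P) (hQ : IsCoatom Q)
    (hPQ : P ≠ Q) (hN : N ≤ P ⊓ Q) : ¬ IsUniserialModule A (M ⧸ N) := by
  have key : ∀ {P Q : Submodule A M}, N ≤ Q → P.map N.mkQ ≤ Q.map N.mkQ → P ≤ Q := by
    intro P Q hQ h
    have := Submodule.comap_mono (f := N.mkQ) h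
    rw [Submodule.comap_map_mkQ, Submodule.comap_map_mkQ, sup_eq_right.mpr hQ] at this
    exact le_sup_right.trans this
  intro h
  rcases h (P.map N.mkQ) (Q.map N.mkQ) with h | h
  · exact hPQ ((hP.le_iff_eq hQ.1).mp (key (hN.trans inf_le_right) h)).symm
  · exact hPQ ((hQ.le_iff_eq hP.1).mp (key (hN.trans inf_le_left) h))

lemma radPow_le_moduleRad {n : ℕ} (hn : n ≠ 0) : radPow A M n ≤ moduleRad A M := by
  have h1 : radPow A M 1 ≤ moduleRad A M := by
    refine le_sInf fun P hP ↦ ?_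
    rintro _ ⟨x, hx, rfl⟩
    have : IsCoatom (P.comap (⊤ : Submodule A M).subtype) := by
      refine (Submodule.isCoatom_comap_iff fun y ↦ ⟨⟨y, trivial⟩, rfl⟩).mpr hP
    exact (sInf_le this : moduleRad A (⊤ : Submodule A M) ≤ _) hx
  have anti : Antitone (radPow A M) :=
    antitone_nat_of_succ_le fun n ↦ Submodule.map_subtype_le _ _
  exact (anti (Nat.one_le_iff_ne_zero.mpr hn)).trans h1

/-- An `n`-factor serial module with two maximal submodules has length `n`. -/
lemma IsNFactorSerial.length_eq {n : ℕ} (h : IsNFactorSerial A M n) {P Q : Submodule A M}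
    (hP : IsCoatom P) (hQ : IsCoatom Q) (hPQ : P ≠ Q) : Module.length A M = n := by
  obtain ⟨-, -, l, hl, hnl, hu, -⟩ := h
  by_cases h0 : l - n = 0
  · rw [moduleLength_eq_coe_length] at hl
    rw [← Nat.le_antisymm (Nat.sub_eq_zero_iff_le.mp h0) hnl]
    exact_mod_cast hl
  · exact absurd hu <| not_isUniserialModule_quotient hP hQ hPQ <|
      (radPow_le_moduleRad h0).trans (le_inf (sInf_le hP) (sInf_le hQ))

lemma exists_isNFactorSerial_length_eq {n : ℕ}
    (hM : ∃ i, 1 ≤ i ∧ i ≤ n ∧ IsFactorSerial A M i) {P Q : Submodule A M}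
    (hP : IsCoatom P) (hQ : IsCoatom Q) (hPQ : P ≠ Q) :
    ∃ i ≤ n, IsNFactorSerial A M i ∧ Module.length A M = i := by
  obtain ⟨i, -, hin, ⟨-, hu⟩ | hi⟩ := hM
  · rcases hu P Q with h | h
    · exact absurd ((hP.le_iff_eq hQ.1).mp h).symm hPQ
    · exact absurd ((hQ.le_iff_eq hP.1).mp h) hPQ
  · exact ⟨i, hin, hi, hi.length_eq hP hQ hPQ⟩

end FactorSerial

section Uniserial

variable {A : Type v} [Ring A] {M N : Type*} [AddCommGroup M] [Module A M] [AddCommGroup N]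
  [Module A N]

lemma IsUniserialModule.le_of_length_le [IsArtinian A M] [IsNoetherian A M]
    (hM : IsUniserialModule A M) {P Q : Submodule A M}
    (h : Module.length A P ≤ Module.length A Q) : P ≤ Q := by
  rcases hM P Q with hPQ | hQP
  · exact hPQ
  · rcases hQP.eq_or_lt with rfl | hlt
    · exact le_rfl
    · rw [Module.length_submodule, Module.length_submodule] at h
      exact absurd (Submodule.height_strictMono hlt) h.not_gt

lemma IsUniserialModule.of_ker_le (hN : IsUniserialModule A N) (f : M →ₗ[A] N)
    (hf : ∀ P : Submodule A M, P ≠ ⊥ → f.ker ≤ P) : IsUniserialModule A M := by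
  intro P Q
  by_cases hP : P = ⊥
  · simp [hP]
  by_cases hQ : Q = ⊥
  · simp [hQ]
  rcases hN (P.map f) (Q.map f) with h | h
  · have := Submodule.comap_mono (f := f) h
    rw [Submodule.comap_map_eq_self (hf P hP), Submodule.comap_map_eq_self (hf Q hQ)] at this
    exact .inl this
  · have := Submodule.comap_mono (f := f) h
    rw [Submodule.comap_map_eq_self (hf P hP), Submodule.comap_map_eq_self (hf Q hQ)] at this
    exact .inr this

lemma IsUniserialModule.comap [IsArtinian A M] (hs : IsAtom (moduleSoc A M)) {f : M →ₗ[A] N}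
    (hf : f.ker = moduleSoc A M) {P : Submodule A N} (hP : IsUniserialModule A P) :
    IsUniserialModule A (P.comap f) := by
  refine hP.of_ker_le (f.submoduleComap P) fun Q hQ x hx ↦ ?_
  have hx' : (x : M) ∈ f.ker := by simpa [Subtype.ext_iff] using hx
  rw [hf] at hx'
  obtain ⟨y, hy, hyx⟩ := moduleSoc_le_of_ne_bot hs
    (map_subtype_ne_bot hQ) hx'
  rwa [← Subtype.ext (a1 := y) (a2 := x) hyx]

end Uniserial

section Gluing

variable {A : Type v} [Ring A] {M V : Type u} [AddCommGroup M] [Module A M]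
  [AddCommGroup V] [Module A V]

/-- The pushout of `h⁻¹(M1)` and `h⁻¹(M2)` along `ker h`, realized inside `V × M`. -/
def kerPushout (h : V →ₗ[A] M) (M1 M2 : Submodule A M) : Submodule A (V × M) :=
  M1.comap (LinearMap.snd A V M) ⊓ M2.comap (h ∘ₗ LinearMap.fst A V M - LinearMap.snd A V M)

variable {h : V →ₗ[A] M} {M1 M2 : Submodule A M}

lemma mem_kerPushout {p : V × M} :
    p ∈ kerPushout h M1 M2 ↔ p.2 ∈ M1 ∧ h p.1 - p.2 ∈ M2 := Iff.rfl

variable (h M1 M2)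

/-- The inclusion of `h⁻¹(M1)` into the pushout. -/
def kerPushoutInl : M1.comap h →ₗ[A] kerPushout h M1 M2 :=
  ((LinearMap.id.prod h) ∘ₗ (M1.comap h).subtype).codRestrict _ fun x ↦
    mem_kerPushout.mpr ⟨x.2, by simp⟩

/-- The inclusion of `h⁻¹(M2)` into the pushout. -/
def kerPushoutInr : M2.comap h →ₗ[A] kerPushout h M1 M2 :=
  (LinearMap.inl A V M ∘ₗ (M2.comap h).subtype).codRestrict _ fun x ↦
    mem_kerPushout.mpr ⟨M1.zero_mem, by simpa using Submodule.mem_comap.mp x.2⟩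

variable {h M1 M2}

lemma coe_kerPushoutInl (x : M1.comap h) :
    (kerPushoutInl h M1 M2 x : V × M) = (x.1, h x.1) := rfl

lemma coe_kerPushoutInr (x : M2.comap h) :
    (kerPushoutInr h M1 M2 x : V × M) = (x.1, 0) := rfl

lemma kerPushoutInl_eq_kerPushoutInr {x : V} (hx : h x = 0) :
    kerPushoutInl h M1 M2 ⟨x, by simp [hx]⟩ = kerPushoutInr h M1 M2 ⟨x, by simp [hx]⟩ := by
  ext1
  exact Prod.ext rfl hx

lemma length_kerPushout (hh : Function.Surjective h) :
    Module.length A (kerPushout h M1 M2) =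
      Module.length A (M2.comap h) + Module.length A M1 := by
  refine Module.length_eq_add_of_exact (kerPushoutInr h M1 M2)
    ((LinearMap.snd A V M).restrict (p := kerPushout h M1 M2) (q := M1) fun _ hp ↦ hp.1)
    (fun x y hxy ↦ ?_) (fun m ↦ ?_) fun p ↦ ⟨fun hp ↦ ?_, ?_⟩
  · exact Subtype.ext (congrArg (fun p ↦ p.1.1) hxy)
  · obtain ⟨v, hv⟩ := hh m
    exact ⟨⟨(v, m), mem_kerPushout.mpr ⟨m.2, by simp [hv]⟩⟩, rfl⟩
  · have hp0 : p.1.2 = 0 := congrArg Subtype.val hp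
    have hp2 := p.2.2
    refine ⟨⟨p.1.1, by simpa [hp0] using hp2⟩, ?_⟩
    ext1
    exact Prod.ext rfl hp0.symm
  · rintro ⟨y, rfl⟩
    rfl

lemma surjective_of_kerPushout (hh : Function.Surjective h) (hsup : M1 ⊔ M2 = ⊤) :
    Function.Surjective (h ∘ₗ LinearMap.fst A V M ∘ₗ (kerPushout h M1 M2).subtype) := by
  intro m
  obtain ⟨m1, h1, m2, h2, rfl⟩ := Submodule.mem_sup.mp (hsup ▸ Submodule.mem_top (x := m))
  obtain ⟨v, hv⟩ := hh (m1 + m2)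
  exact ⟨⟨(v, m1), mem_kerPushout.mpr ⟨h1, by simpa [hv] using h2⟩⟩, hv⟩

lemma exists_eq_add_of_mem_kerPushout (hh : Function.Surjective h) {p : kerPushout h M1 M2}
    (h1 : p.1.1 ∈ (M1 ⊓ M2).comap h) (h2 : p.1.2 ∈ M1 ⊓ M2) :
    ∃ x y, ∃ hx : x ∈ (M1 ⊓ M2).comap h, ∃ hy : y ∈ (M1 ⊓ M2).comap h,
      p = kerPushoutInl h M1 M2 ⟨x, hx.1⟩ + kerPushoutInr h M1 M2 ⟨y, hy.2⟩ := by
  obtain ⟨w, hw⟩ := hh p.1.2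
  have hw' : w ∈ (M1 ⊓ M2).comap h := by simpa only [Submodule.mem_comap, hw] using h2
  refine ⟨w, p.1.1 - w, hw', sub_mem h1 hw', ?_⟩
  ext1
  rw [Submodule.coe_add, coe_kerPushoutInl, coe_kerPushoutInr]
  exact Prod.ext (by simp) (by simp [hw])


lemma apply_eq_zero_of_length_le_one [IsArtinianRing A] [Module.Finite A V]
    (hh : Function.Surjective h) (hs : IsAtom (moduleSoc A V))
    (hker : h.ker = moduleSoc A V) (hu : IsUniserialModule A M1) (hl : Module.length A M1 = 2)
    {S : Submodule A M} (hS : Module.length A S = 1) (hS1 : S ≤ M1)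
    {C : Type*} [AddCommGroup C] [Module A C] (hC : Module.length A C ≤ 1)
    (c : M1.comap h →ₗ[A] C) {x : V} (hx : x ∈ S.comap h) :
    c ⟨x, Submodule.comap_mono hS1 hx⟩ = 0 := by
  have hk : Module.length A h.ker = 1 := hker ▸ isAtom_iff_length_eq_one.mp hs
  have hV1 := length_comap_of_surjective hh M1
  have hW := length_comap_of_surjective hh S
  have hW1 := (Submodule.comapSubtypeEquivOfLe (Submodule.comap_mono (f := h) hS1)).length_eq
  have hc := length_eq_length_ker_add_length_range c
  have hr : Module.length A c.range ≤ 1 :=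
    (Module.length_le_of_injective c.range.subtype (Submodule.subtype_injective _)).trans hC
  refine (hu.comap hs hker).le_of_length_le (P := (S.comap h).comap (M1.comap h).subtype)
    (Q := c.ker) ?_ hx
  rw [hW1, hW, hk, hS]
  rw [hV1, hk, hl] at hc
  have : (1 + 2 : ℕ∞) ≤ Module.length A c.ker + 1 := hc.trans_le (by gcongr)
  have h3 : (1 + 2 : ℕ∞) = (1 + 1) + 1 := by norm_num
  rw [h3] at this
  exact (ENat.add_le_add_iff_right ENat.one_ne_top).mp this

lemma exists_linearMap_comap_of_isCompl [IsArtinianRing A] [Module.Finite A V]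
    [Module.Finite A M]
    (hh : Function.Surjective h) (hs : IsAtom (moduleSoc A V))
    (hker : h.ker = moduleSoc A V) (hu1 : IsUniserialModule A M1) (hu2 : IsUniserialModule A M2)
    (hl1 : Module.length A M1 = 2) (hl2 : Module.length A M2 = 2)
    (hsM : IsAtom (moduleSoc A M)) (hS : moduleSoc A M = M1 ⊓ M2)
    {B C : Submodule A (kerPushout h M1 M2)} (hBC : IsCompl B C) (hC : C ≠ ⊥)
    {k : V} (hk : h k = 0)
    (hkB : B.projectionOnto C hBC (kerPushoutInr h M1 M2 ⟨k, by simp [hk]⟩) ≠ 0) :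
    ∃ f : M2.comap h →ₗ[A] M1.comap h, ∀ x (hx : h x = 0), (f ⟨x, by simp [hx]⟩ : V) = x := by
  have hlk : Module.length A h.ker = 1 := hker ▸ isAtom_iff_length_eq_one.mp hs
  have hlS : Module.length A (M1 ⊓ M2 : Submodule A M) = 1 :=
    isAtom_iff_length_eq_one.mp (hS ▸ hsM)
  let a : M1.comap h →ₗ[A] B := B.projectionOnto C hBC ∘ₗ kerPushoutInl h M1 M2
  have hinj : a.ker = ⊥ := by
    by_contra hne
    have hle := moduleSoc_le_of_ne_bot hs (map_subtype_ne_bot hne)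
    obtain ⟨y, hy, hyk⟩ := hle (hker ▸ hk : k ∈ moduleSoc A V)
    refine hkB ?_
    rw [← kerPushoutInl_eq_kerPushoutInr hk]
    have : y = ⟨k, by simp [hk]⟩ := Subtype.ext hyk
    exact this ▸ hy
  rcases bijective_or_length_lt_of_ker_eq_bot (M := M1.comap h) (N := B) a hinj with hbij | hla
  · let e := LinearEquiv.ofBijective a hbij
    refine ⟨e.symm.toLinearMap ∘ₗ B.projectionOnto C hBC ∘ₗ kerPushoutInr h M1 M2,
      fun x hx ↦ ?_⟩
    have : e ⟨x, by simp [hx]⟩ =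
        B.projectionOnto C hBC (kerPushoutInr h M1 M2 ⟨x, by simp [hx]⟩) := by
      rw [← kerPushoutInl_eq_kerPushoutInr hx]
      rfl
    simp [← this]
  · exfalso
    rw [length_comap_of_surjective hh, hlk, hl1] at hla
    have hlX := length_kerPushout (M1 := M1) (M2 := M2) hh
    rw [length_comap_of_surjective hh, hlk, hl2, hl1,
      length_eq_add_of_isCompl (M := kerPushout h M1 M2) hBC] at hlX
    have hlC : Module.length A C ≤ 1 := by
      obtain ⟨b, hb⟩ := exists_length_eq_natCast (A := A) B
      obtain ⟨c, hc⟩ := exists_length_eq_natCast (A := A) C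
      rw [hb] at hla hlX
      rw [hc] at hlX ⊢
      norm_cast at *
      omega
    refine hC ((Submodule.eq_bot_iff C).mpr fun p hp ↦ ?_)
    have h1 : p.1.1 ∈ (M1 ⊓ M2).comap h := by
      have := map_le_moduleSoc (LinearMap.fst A V M ∘ₗ (kerPushout h M1 M2).subtype) hlC
        (Submodule.mem_map_of_mem hp)
      rw [← hker] at this
      exact (congrArg (· ∈ M1 ⊓ M2) (LinearMap.mem_ker.mp this)).mpr (zero_mem _)
    have h2 : p.1.2 ∈ M1 ⊓ M2 := hS ▸
      map_le_moduleSoc (LinearMap.snd A V M ∘ₗ (kerPushout h M1 M2).subtype) hlC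
        (Submodule.mem_map_of_mem hp)
    obtain ⟨x, y, hx, hy, hxy⟩ := exists_eq_add_of_mem_kerPushout hh h1 h2
    let c := C.projectionOnto B hBC.symm
    have hx0 := apply_eq_zero_of_length_le_one hh hs hker hu1 hl1 hlS inf_le_left hlC
      (c ∘ₗ kerPushoutInl h M1 M2) hx
    have hy0 := apply_eq_zero_of_length_le_one hh hs hker hu2 hl2 hlS inf_le_right hlC
      (c ∘ₗ kerPushoutInr h M1 M2) hy
    have hcp : c p = 0 := by
      rw [hxy, map_add]
      exact (congrArg₂ (· + ·) hx0 hy0).trans (add_zero _)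
    have : c p = ⟨p, hp⟩ := Submodule.projectionOnto_apply_left hBC.symm ⟨p, hp⟩
    exact congrArg Subtype.val (this.symm.trans hcp)

lemma not_exists_linearMap_comap [IsArtinian A M]
    (hh : Function.Surjective h) (hs : IsAtom (moduleSoc A V)) (hker : h.ker = moduleSoc A V)
    (hsM : IsAtom (moduleSoc A M)) (hS : moduleSoc A M = M1 ⊓ M2) (h21 : ¬ M2 ≤ M1)
    (f : M2.comap h →ₗ[A] M1.comap h)
    (hf : ∀ x (hx : h x = 0), (f ⟨x, by simp [hx]⟩ : V) = x) : False := by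
  have hlk : Module.length A h.ker = 1 := hker ▸ isAtom_iff_length_eq_one.mp hs
  have hlS : Module.length A (M1 ⊓ M2 : Submodule A M) = 1 :=
    isAtom_iff_length_eq_one.mp (hS ▸ hsM)
  let g : M2.comap h →ₗ[A] V := (M2.comap h).subtype - (M1.comap h).subtype ∘ₗ f
  have hfix : ∀ x (hx : x ∈ (M1 ⊓ M2).comap h), h (g ⟨x, hx.2⟩) = 0 := by
    let r : (M1 ⊓ M2).comap h →ₗ[A] V :=
      g ∘ₗ Submodule.inclusion (Submodule.comap_mono inf_le_right)
    have hkr : h.ker.comap ((M1 ⊓ M2).comap h).subtype ≤ r.ker := fun x hx ↦ by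
      have := hf x.1 hx
      exact sub_eq_zero.mpr this.symm
    have hlr : Module.length A r.range ≤ 1 := by
      have h1 := length_eq_length_ker_add_length_range r
      rw [length_comap_of_surjective hh, hlk, hlS] at h1
      have h2 := Module.length_le_of_injective _ (Submodule.inclusion_injective hkr)
      rw [(Submodule.comapSubtypeEquivOfLe (LinearMap.ker_le_comap h :
        h.ker ≤ (M1 ⊓ M2).comap h)).length_eq, hlk] at h2
      have h3 : 1 + Module.length A r.range ≤ 1 + 1 := by
        rw [h1]
        gcongr
      exact (ENat.add_le_add_iff_left ENat.one_ne_top).mp h3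
    intro x hx
    have := le_moduleSoc_of_length_le_one hlr ⟨⟨x, hx⟩, rfl⟩
    rw [← hker] at this
    exact this
  obtain ⟨m, hm2, hm1⟩ := SetLike.not_le_iff_exists.mp h21
  obtain ⟨v, rfl⟩ := hh m
  have hmem : ∀ x : M2.comap h, h (g x) ∈ M1 → h x ∈ M1 := fun x hx ↦ by
    have hfx : h (f x) ∈ M1 := (f x).2
    have : h x = h (g x) + h (f x) := by simp [g]
    exact this ▸ add_mem hx hfx
  have hne : (h ∘ₗ g).range ≠ ⊥ := fun h0 ↦ by
    have : h (g ⟨v, hm2⟩) = 0 := LinearMap.congr_fun (LinearMap.range_eq_bot.mp h0) ⟨v, hm2⟩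
    exact hm1 (hmem ⟨v, hm2⟩ (this ▸ zero_mem _))
  have hle := moduleSoc_le_of_ne_bot hsM hne
  refine hsM.1 ((Submodule.eq_bot_iff _).mpr fun s hs' ↦ ?_)
  obtain ⟨x, rfl⟩ := hle hs'
  exact hfix x ⟨hmem x (hS ▸ hs' : _ ∈ M1 ⊓ M2).1, x.2⟩

/-- If every indecomposable module is `i`-factor serial for some `i ≤ 4`, then no colocal module
is an extension by its socle of a colocal module with two distinct maximal submodules,
both uniserial of length `2`. -/
lemma not_surjective_of_isAtom_moduleSoc [IsArtinianRing A] [Module.Finite A V]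
    [Module.Finite A M]
    (H : ∀ X : ModuleCat.{u} A, Module.Finite A X → IsIndecModule A X →
      ∃ i, 1 ≤ i ∧ i ≤ 4 ∧ IsFactorSerial A X i)
    (hM1 : IsCoatom M1) (hM2 : IsCoatom M2) (hne : M1 ≠ M2)
    (hu1 : IsUniserialModule A M1) (hu2 : IsUniserialModule A M2)
    (hl1 : Module.length A M1 = 2) (hl2 : Module.length A M2 = 2)
    (hsM : IsAtom (moduleSoc A M)) (hS : moduleSoc A M = M1 ⊓ M2)
    (hs : IsAtom (moduleSoc A V)) (hker : h.ker = moduleSoc A V) :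
    ¬ Function.Surjective h := by
  intro hh
  have h21 : ¬ M2 ≤ M1 := fun h ↦ hne ((hM2.le_iff_eq hM1.1).mp h)
  have hsup : M1 ⊔ M2 = ⊤ := hM1.sup_eq_top_of_ne hM2 hne
  have hlk : Module.length A h.ker = 1 := hker ▸ isAtom_iff_length_eq_one.mp hs
  obtain ⟨k, hk, hk0⟩ := (Submodule.ne_bot_iff _).mp hs.1
  have hk : h k = 0 := hker.ge hk
  let x := kerPushoutInr h M1 M2 ⟨k, by simp [hk]⟩
  have hx0 : x ≠ 0 := fun h0 ↦ hk0 (congrArg (fun p ↦ p.1.1) h0)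
  have hlX := length_kerPushout (M1 := M1) (M2 := M2) hh
  rw [length_comap_of_surjective hh, hlk, hl2, hl1] at hlX
  have hnind : ¬ IsIndecModule A (kerPushout h M1 M2) := fun hX ↦ by
    have hf := surjective_of_kerPushout (M1 := M1) (M2 := M2) hh hsup
    obtain ⟨i, hi, -, hli⟩ := exists_isNFactorSerial_length_eq
      (H (.of A (kerPushout h M1 M2)) inferInstance hX)
      ((Submodule.isCoatom_comap_iff hf).mpr hM1) ((Submodule.isCoatom_comap_iff hf).mpr hM2)
      (fun h ↦ hne (Submodule.comap_injective_of_surjective hf h))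
    have : (1 + 2 + 2 : ℕ∞) = i := hlX.symm.trans hli
    norm_cast at this
    omega
  have : Nontrivial (kerPushout h M1 M2) := ⟨x, 0, hx0⟩
  simp only [IsIndecModule, this, true_and, not_forall, not_or] at hnind
  obtain ⟨B, C, hBC, hB, hC⟩ := hnind
  by_cases hxB : B.projectionOnto C hBC x = 0
  · have hxC : C.projectionOnto B hBC.symm x ≠ 0 := fun hxC ↦
      hx0 (hBC.disjoint.le_bot (x := x)
        ⟨(Submodule.projectionOnto_apply_eq_zero_iff hBC.symm).mp hxC,
          (Submodule.projectionOnto_apply_eq_zero_iff hBC).mp hxB⟩)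
    obtain ⟨f, hf⟩ := exists_linearMap_comap_of_isCompl hh hs hker hu1 hu2 hl1 hl2 hsM hS
      hBC.symm hB hk hxC
    exact not_exists_linearMap_comap hh hs hker hsM hS h21 f hf
  · obtain ⟨f, hf⟩ := exists_linearMap_comap_of_isCompl hh hs hker hu1 hu2 hl1 hl2 hsM hS
      hBC hC hk hxB
    exact not_exists_linearMap_comap hh hs hker hsM hS h21 f hf

end Gluing

section AlmostSplitCriterion

variable {A : Type v} [Ring A]

/-- To lift all non-split maps through `g`, it is enough to lift those from indecomposables. -/
lemma exists_comp_eq_of_forall_isIndecModule [IsArtinianRing A] {Y Z : Type w} [AddCommGroup Y]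
    [Module A Y] [AddCommGroup Z] [Module A Z] (g : Y →ₗ[A] Z)
    (hg : ∀ (V : Type w) [AddCommGroup V] [Module A V] [Module.Finite A V], IsIndecModule A V →
      ∀ h : V →ₗ[A] Z, (¬ ∃ s : Z →ₗ[A] V, h ∘ₗ s = LinearMap.id) →
        ∃ k : V →ₗ[A] Y, g ∘ₗ k = h)
    (V : Type w) [AddCommGroup V] [Module A V] [Module.Finite A V] (h : V →ₗ[A] Z)
    (hh : ¬ ∃ s : Z →ₗ[A] V, h ∘ₗ s = LinearMap.id) : ∃ k : V →ₗ[A] Y, g ∘ₗ k = h := by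
  obtain ⟨n, hn⟩ := exists_length_eq_natCast (A := A) V
  induction n using Nat.strong_induction_on generalizing V with
  | _ n ih =>
  by_cases hV : IsIndecModule A V
  · exact hg V hV h hh
  rcases subsingleton_or_nontrivial V with hV0 | hV0
  · exact ⟨0, LinearMap.ext fun x ↦ by simp [Subsingleton.elim x 0]⟩
  simp only [IsIndecModule, hV0, true_and, not_forall, not_or] at hV
  obtain ⟨N, P, hNP, hN, hP⟩ := hV
  have aux : ∀ Q : Submodule A V, Q ≠ ⊤ → ∃ k : Q →ₗ[A] Y, g ∘ₗ k = h ∘ₗ Q.subtype := by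
    intro Q hQ
    obtain ⟨m, hm⟩ := exists_length_eq_natCast (A := A) Q
    have hlt := Submodule.length_lt hQ
    rw [hm, hn] at hlt
    refine ih m (by exact_mod_cast hlt) Q _ (fun ⟨s, hs⟩ ↦ hh ⟨Q.subtype ∘ₗ s, ?_⟩) hm
    rw [← hs, LinearMap.comp_assoc]
  obtain ⟨k1, hk1⟩ := aux N fun h ↦ hP (by simpa [h] using hNP.inf_eq_bot)
  obtain ⟨k2, hk2⟩ := aux P fun h ↦ hN (by simpa [h] using hNP.inf_eq_bot)
  refine ⟨k1 ∘ₗ N.projectionOnto P hNP + k2 ∘ₗ P.projectionOnto N hNP.symm, ?_⟩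
  rw [LinearMap.comp_add, ← LinearMap.comp_assoc, ← LinearMap.comp_assoc, hk1, hk2]
  ext x
  have : N.projection P hNP x + P.projection N hNP.symm x = x :=
    Submodule.projection_add_projection_eq_self hNP x
  simp [← map_add, this]

lemma isIndecModule_of_isAtom {M : Type w} [AddCommGroup M] [Module A M] {S : Submodule A M}
    (hS : IsAtom S) : IsIndecModule A S := by
  have := isSimpleModule_iff_isAtom.mpr hS
  refine ⟨IsSimpleModule.nontrivial A S, fun N P hNP ↦ (eq_bot_or_eq_top N).imp_right ?_⟩
  rintro rfl
  simpa using hNP.inf_eq_bot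

end AlmostSplitCriterion

section DifferenceMap

variable {A : Type v} [Ring A] {M : Type u} [AddCommGroup M] [Module A M]

/-- The difference map `(m1, m2) ↦ m2 - m1` from the direct sum of two submodules. -/
def subMap (M1 M2 : Submodule A M) : (M1 × M2) →ₗ[A] M :=
  (M2.subtype ∘ₗ LinearMap.snd A M1 M2) - (M1.subtype ∘ₗ LinearMap.fst A M1 M2)

variable {M1 M2 : Submodule A M}

lemma subMap_apply (p : M1 × M2) : subMap M1 M2 p = p.2 - p.1 := rfl

lemma surjective_subMap (hsup : M1 ⊔ M2 = ⊤) : Function.Surjective (subMap M1 M2) := by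
  intro m
  obtain ⟨x, hx, y, hy, rfl⟩ := Submodule.mem_sup.mp (hsup ▸ Submodule.mem_top (x := m))
  exact ⟨(-⟨x, hx⟩, ⟨y, hy⟩), by simp [subMap_apply, add_comm]⟩

lemma range_prod_inclusion_eq_ker_subMap {S : Submodule A M} (hS : S = M1 ⊓ M2) (h1 : S ≤ M1)
    (h2 : S ≤ M2) :
    ((Submodule.inclusion h1).prod (Submodule.inclusion h2)).range = (subMap M1 M2).ker := by
  ext ⟨x, y⟩
  rw [LinearMap.mem_ker, subMap_apply, sub_eq_zero]
  constructor
  · rintro ⟨s, hs⟩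
    rw [← hs]
    rfl
  · intro hxy
    exact ⟨⟨x, hS ▸ ⟨x.2, (hxy : (y : M) = x) ▸ y.2⟩⟩,
      Prod.ext (Subtype.ext rfl) (Subtype.ext hxy.symm)⟩

lemma not_exists_section_subMap [IsArtinian A M] [IsNoetherian A M]
    (hs : IsAtom (moduleSoc A M)) (h1 : M1 ≠ ⊤) (h2 : M2 ≠ ⊤) :
    ¬ ∃ s : M →ₗ[A] M1 × M2, subMap M1 M2 ∘ₗ s = LinearMap.id := by
  rintro ⟨s, hs'⟩
  have key : ∀ {N : Submodule A M} (_ : N ≠ ⊤) (f : M →ₗ[A] N), moduleSoc A M ≤ f.ker := by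
    intro N hN f
    refine moduleSoc_le_of_ne_bot hs fun hf ↦ (Submodule.length_lt hN).not_ge ?_
    exact Module.length_le_of_injective f (LinearMap.ker_eq_bot.mp hf)
  obtain ⟨x, hx, hx0⟩ := (Submodule.ne_bot_iff _).mp hs.1
  have e1 : (s x).1 = 0 := key h1 (LinearMap.fst A M1 M2 ∘ₗ s) hx
  have e2 : (s x).2 = 0 := key h2 (LinearMap.snd A M1 M2 ∘ₗ s) hx
  refine hx0 ?_
  rw [← LinearMap.id_apply (R := A) x, ← hs', LinearMap.comp_apply, subMap_apply, e1, e2]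
  simp

lemma exists_subMap_comp_eq_of_range_le {V : Type*} [AddCommGroup V] [Module A V]
    {h : V →ₗ[A] M} (hh : h.range ≤ M1 ∨ h.range ≤ M2) :
    ∃ k : V →ₗ[A] M1 × M2, subMap M1 M2 ∘ₗ k = h := by
  rcases hh with hh | hh
  · refine ⟨LinearMap.inl A M1 M2 ∘ₗ (-h.codRestrict M1 fun x ↦ hh ⟨x, rfl⟩), ?_⟩
    ext x
    simp [subMap_apply]
  · refine ⟨LinearMap.inr A M1 M2 ∘ₗ h.codRestrict M2 fun x ↦ hh ⟨x, rfl⟩, ?_⟩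
    ext x
    simp [subMap_apply]

end DifferenceMap

theorem almost_split_sequence_of_nonlocal_three_factor_serial
    (R : Type*) [CommRing R] [IsArtinianRing R]
    (Λ : Type u) [Ring Λ] [Algebra R Λ] [Module.Finite R Λ]
    (hΛ : IsRightNNakayama Λ 4)
    (M : Type u) [AddCommGroup M] [Module Λᵐᵒᵖ M] [Module.Finite Λᵐᵒᵖ M]
    (hind : IsIndecModule Λᵐᵒᵖ M) (hnl : ¬ IsLocalModule Λᵐᵒᵖ M)
    (hfs : IsNFactorSerial Λᵐᵒᵖ M 3)
    (hnq : ¬ ∃ L : ModuleCat.{u} Λᵐᵒᵖ, Module.Finite Λᵐᵒᵖ L ∧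
      IsIndecModule Λᵐᵒᵖ L ∧ ¬ IsLocalModule Λᵐᵒᵖ L ∧
      ¬ IsColocalModule Λᵐᵒᵖ L ∧ IsNFactorSerial Λᵐᵒᵖ L 4 ∧
      ∃ f : L →ₗ[Λᵐᵒᵖ] M, Function.Surjective f)
    (M1 M2 : Submodule Λᵐᵒᵖ M) (hM1 : IsCoatom M1) (hM2 : IsCoatom M2) (hne : M1 ≠ M2)
    (hu1 : IsUniserialModule Λᵐᵒᵖ ↑M1) (hu2 : IsUniserialModule Λᵐᵒᵖ ↑M2)
    (hl1 : moduleLength Λᵐᵒᵖ ↑M1 = (2 : ℕ)) (hl2 : moduleLength Λᵐᵒᵖ ↑M2 = (2 : ℕ))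
    (honly : ∀ N : Submodule Λᵐᵒᵖ M, IsCoatom N → N = M1 ∨ N = M2)
    (hS : moduleSoc Λᵐᵒᵖ M = M1 ⊓ M2) (hatom : IsAtom (moduleSoc Λᵐᵒᵖ M)) :
    IsAlmostSplitSequence
      (LinearMap.prod
        (Submodule.inclusion (hS.le.trans inf_le_left))
        (Submodule.inclusion (hS.le.trans inf_le_right)))
      ((M2.subtype ∘ₗ LinearMap.snd Λᵐᵒᵖ ↑M1 ↑M2) -
        (M1.subtype ∘ₗ LinearMap.fst Λᵐᵒᵖ ↑M1 ↑M2)) := by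
  have hart : IsArtinianRing Λᵐᵒᵖ := .of_finite R Λᵐᵒᵖ
  have hlen1 : Module.length Λᵐᵒᵖ M1 = 2 := by
    rw [moduleLength_eq_coe_length] at hl1
    exact WithBot.coe_injective hl1
  have hlen2 : Module.length Λᵐᵒᵖ M2 = 2 := by
    rw [moduleLength_eq_coe_length] at hl2
    exact WithBot.coe_injective hl2
  have hsup : M1 ⊔ M2 = ⊤ := hM1.sup_eq_top_of_ne hM2 hne
  refine ⟨?_, surjective_subMap hsup, range_prod_inclusion_eq_ker_subMap hS _ _,
    not_exists_section_subMap hatom hM1.1 hM2.1, isIndecModule_of_isAtom hatom, hind, ?_⟩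
  · intro x y hxy
    exact Submodule.inclusion_injective _ (congrArg Prod.fst hxy)
  intro V _ h hh
  refine exists_comp_eq_of_forall_isIndecModule (subMap M1 M2) ?_ V h hh
  intro V _ _ _ hV h hh
  by_cases hsurj : Function.Surjective h
  swap
  · obtain ⟨N, hN, hle⟩ := (eq_top_or_exists_le_coatom h.range).resolve_left
      fun hr ↦ hsurj (LinearMap.range_eq_top.mp hr)
    refine exists_subMap_comp_eq_of_range_le ?_
    rcases honly N hN with rfl | rfl
    exacts [.inl hle, .inr hle]
  exfalso
  have hinj : ¬ Function.Injective h := fun hinj ↦ by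
    let e := LinearEquiv.ofBijective h ⟨hinj, hsurj⟩
    exact hh ⟨e.symm, LinearMap.ext e.apply_symm_apply⟩
  have hker : h.ker ≠ ⊥ := fun hk ↦ hinj (LinearMap.ker_eq_bot.mp hk)
  have hV1 := (Submodule.isCoatom_comap_iff hsurj).mpr hM1
  have hV2 := (Submodule.isCoatom_comap_iff hsurj).mpr hM2
  have hV12 : M1.comap h ≠ M2.comap h := fun h ↦
    hne (Submodule.comap_injective_of_surjective hsurj h)
  obtain ⟨i, hi4, hVi, hli⟩ := exists_isNFactorSerial_length_eq
    (hΛ.1 (.of Λᵐᵒᵖ V) inferInstance hV) hV1 hV2 hV12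
  have hlV := length_eq_of_isCoatom hV1
  rw [length_comap_of_surjective hsurj, hlen1] at hlV
  have hlV : Module.length Λᵐᵒᵖ V = _ := hlV
  have hli : Module.length Λᵐᵒᵖ V = i := hli
  obtain ⟨n, hn⟩ := exists_length_eq_natCast (A := Λᵐᵒᵖ) h.ker
  have hn0 : n ≠ 0 := by
    rintro rfl
    exact hker (Submodule.subsingleton_iff_eq_bot.mp (Module.length_eq_zero_iff.mp hn))
  rw [hli, hn] at hlV
  norm_cast at hlV
  obtain ⟨rfl, rfl⟩ : i = 4 ∧ n = 1 := by omega
  have hcol : IsAtom (moduleSoc Λᵐᵒᵖ V) := by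
    by_contra hcol
    exact hnq ⟨.of Λᵐᵒᵖ V, inferInstance, hV,
      fun hloc ↦ hV12 (hloc.unique hV1 hV2), hcol, hVi, h, hsurj⟩
  have hks : h.ker = moduleSoc Λᵐᵒᵖ V :=
    (hcol.le_iff_eq hker).mp (le_moduleSoc_of_length_le_one (by simp [hn]))
  exact not_surjective_of_isAtom_moduleSoc hΛ.1 hM1 hM2 hne hu1 hu2 hlen1 hlen2 hatom hS hcol hks
    hsurj
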